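/- Convexity of the Renyi divergence for hot thermal resources (analytic content of Theorem 3): Let n ≥ 1, E : Fin n → ℝ, and β_R ≤ β be reals. If the thermal energy function t ↦ Eav t is convex on the interval Set.Icc β_R β, then the function α ↦ (α − 1)⁻¹ · Real.log (Σ_i (ω β_R i)^α · (ω β i)^(1−α)) is convex on Set.Ico (0 : ℝ) 1. -/

import Mathlib

/-- Partition function of energies `E` at inverse temperature `t`. -/
noncomputable def Zf {n : ℕ} (E : Fin n → ℝ) (t : ℝ) : ℝ := ∑ i, Real.exp (-t * E i)

/-- Gibbs distribution of energies `E` at inverse temperature `t`. -/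
noncomputable def gibbs {n : ℕ} (E : Fin n → ℝ) (t : ℝ) (i : Fin n) : ℝ :=
  Real.exp (-t * E i) / Zf E t

/-- Thermal average energy. -/
noncomputable def Eav {n : ℕ} (E : Fin n → ℝ) (t : ℝ) : ℝ := ∑ i, E i * gibbs E t i

lemma Zf_pos {n : ℕ} (hn : 1 ≤ n) (E : Fin n → ℝ) (t : ℝ) : 0 < Zf E t :=
  Finset.sum_pos (fun _ _ => Real.exp_pos _) ⟨⟨0, hn⟩, Finset.mem_univ _⟩

lemma hasDerivAt_Zf {n : ℕ} (E : Fin n → ℝ) (t : ℝ) :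
    HasDerivAt (Zf E) (-∑ i, E i * Real.exp (-t * E i)) t := by
  have key : HasDerivAt (fun t => ∑ i, Real.exp (-t * E i))
      (∑ i, Real.exp (-t * E i) * (-1 * E i)) t :=
    HasDerivAt.fun_sum fun i _ => (((hasDerivAt_id t).neg).mul_const (E i)).exp
  refine key.congr_deriv ?_
  rw [← Finset.sum_neg_distrib]
  exact Finset.sum_congr rfl fun i _ => by ring

lemma Eav_eq_div {n : ℕ} (E : Fin n → ℝ) (t : ℝ) :
    Eav E t = (∑ i, E i * Real.exp (-t * E i)) / Zf E t := by
  simp only [Eav, gibbs, Finset.sum_div, mul_div_assoc]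

lemma hasDerivAt_log_Zf {n : ℕ} (hn : 1 ≤ n) (E : Fin n → ℝ) (t : ℝ) :
    HasDerivAt (fun t => Real.log (Zf E t)) (-Eav E t) t := by
  rw [Eav_eq_div, ← neg_div]
  exact (hasDerivAt_Zf E t).log (Zf_pos hn E t).ne'

lemma continuous_Eav {n : ℕ} (hn : 1 ≤ n) (E : Fin n → ℝ) : Continuous (Eav E) := by
  rw [funext (Eav_eq_div E)]
  have hZ : Continuous (Zf E) :=
    continuous_iff_continuousAt.2 fun t => (hasDerivAt_Zf E t).continuousAt
  exact Continuous.div (by fun_prop) hZ fun t => (Zf_pos hn E t).ne'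

lemma integral_Eav {n : ℕ} (hn : 1 ≤ n) (E : Fin n → ℝ) (a c : ℝ) :
    c * ∫ u in (0:ℝ)..1, Eav E (a + c * u) = Real.log (Zf E a) - Real.log (Zf E (a + c)) := by
  have hcont := continuous_Eav hn E
  have hderiv (u : ℝ) : HasDerivAt (fun u => -Real.log (Zf E (a + c * u)))
      (c * Eav E (a + c * u)) u := by
    have hlin : HasDerivAt (fun u : ℝ => a + c * u) c u := by
      simpa using ((hasDerivAt_id u).const_mul c).const_add a
    have hcomp := ((hasDerivAt_log_Zf hn E (a + c * u)).comp u hlin).neg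
    exact hcomp.congr_deriv (by ring)
  rw [← intervalIntegral.integral_const_mul,
    intervalIntegral.integral_eq_sub_of_hasDerivAt (fun u _ => hderiv u)
      (Continuous.intervalIntegrable (by fun_prop) _ _)]
  simp only [mul_one, mul_zero, add_zero]
  ring

lemma log_sum_gibbs_rpow {n : ℕ} (hn : 1 ≤ n) (E : Fin n → ℝ) (a b α : ℝ) :
    Real.log (∑ i, gibbs E a i ^ α * gibbs E b i ^ (1 - α)) =
      Real.log (Zf E (a + (1 - α) * (b - a))) - α * Real.log (Zf E a)
        - (1 - α) * Real.log (Zf E b) := by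
  have hgibbs (t : ℝ) (i : Fin n) :
      gibbs E t i = Real.exp (-t * E i - Real.log (Zf E t)) := by
    rw [Real.exp_sub, Real.exp_log (Zf_pos hn E t), gibbs]
  have hsum : ∑ i, gibbs E a i ^ α * gibbs E b i ^ (1 - α) =
      Zf E (a + (1 - α) * (b - a)) *
        Real.exp (-(α * Real.log (Zf E a) + (1 - α) * Real.log (Zf E b))) := by
    rw [Zf, Finset.sum_mul]
    refine Finset.sum_congr rfl fun i _ => ?_
    rw [hgibbs, hgibbs, ← Real.exp_mul, ← Real.exp_mul, ← Real.exp_add, ← Real.exp_add]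
    congr 1
    ring
  rw [hsum, Real.log_mul (Zf_pos hn E _).ne' (Real.exp_pos _).ne', Real.log_exp]
  ring

lemma renyi_gibbs_eq_integral {n : ℕ} (hn : 1 ≤ n) (E : Fin n → ℝ) (a b : ℝ) {α : ℝ}
    (hα : α ≠ 1) :
    (α - 1)⁻¹ * Real.log (∑ i, gibbs E a i ^ α * gibbs E b i ^ (1 - α)) =
      (b - a) * (∫ u in (0:ℝ)..1, Eav E (a + (1 - α) * (b - a) * u))
        + (Real.log (Zf E b) - Real.log (Zf E a)) := by
  have hint := integral_Eav hn E a ((1 - α) * (b - a))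
  have hα' : α - 1 ≠ 0 := sub_ne_zero.2 hα
  rw [log_sum_gibbs_rpow hn, inv_mul_eq_iff_eq_mul₀ hα']
  linear_combination hint

lemma convexOn_integral_Eav {n : ℕ} (hn : 1 ≤ n) (E : Fin n → ℝ) {a b : ℝ} (h : a ≤ b)
    (hconv : ConvexOn ℝ (Set.Icc a b) (Eav E)) :
    ConvexOn ℝ (Set.Icc (0:ℝ) 1)
      (fun α => ∫ u in (0:ℝ)..1, Eav E (a + (1 - α) * (b - a) * u)) := by
  have hcont := continuous_Eav hn E
  have hmem {α u : ℝ} (hα : α ∈ Set.Icc (0:ℝ) 1) (hu : u ∈ Set.Icc (0:ℝ) 1) :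
      a + (1 - α) * (b - a) * u ∈ Set.Icc a b := by
    have h₀ : 0 ≤ (1 - α) * u := mul_nonneg (sub_nonneg.2 hα.2) hu.1
    have h₁ : (1 - α) * u ≤ 1 :=
      mul_le_one₀ (sub_le_self _ hα.1) hu.1 hu.2
    constructor <;> nlinarith [sub_nonneg.2 h]
  refine ⟨convex_Icc 0 1, fun x hx y hy p q hp hq hpq => ?_⟩
  simp only [smul_eq_mul]
  rw [← intervalIntegral.integral_const_mul, ← intervalIntegral.integral_const_mul,
    ← intervalIntegral.integral_add (Continuous.intervalIntegrable (by fun_prop) _ _)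
      (Continuous.intervalIntegrable (by fun_prop) _ _)]
  refine intervalIntegral.integral_mono_on zero_le_one
    (Continuous.intervalIntegrable (by fun_prop) _ _)
    (Continuous.intervalIntegrable (by fun_prop) _ _) fun u hu => ?_
  have harg : a + (1 - (p * x + q * y)) * (b - a) * u =
      p * (a + (1 - x) * (b - a) * u) + q * (a + (1 - y) * (b - a) * u) := by
    linear_combination (-(a + (b - a) * u)) * hpq
  rw [harg]
  exact hconv.2 (hmem hx hu) (hmem hy hu) hp hq hpq

theorem renyi_convex_hot_resource (n : ℕ) (hn : 1 ≤ n) (E : Fin n → ℝ)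
    (βR β : ℝ) (h : βR ≤ β)
    (hconv : ConvexOn ℝ (Set.Icc βR β) (fun t => Eav E t)) :
    ConvexOn ℝ (Set.Ico (0:ℝ) 1)
      (fun α : ℝ =>
        (α - 1)⁻¹ * Real.log (∑ i, gibbs E βR i ^ α * gibbs E β i ^ (1 - α))) := by
  have hint := (convexOn_integral_Eav hn E h hconv).subset Set.Ico_subset_Icc_self (convex_Ico 0 1)
  refine ((hint.smul (sub_nonneg.2 h)).add_const
    (Real.log (Zf E β) - Real.log (Zf E βR))).congr fun α hα => ?_
  exact (renyi_gibbs_eq_integral hn E βR β hα.2.ne).symm
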